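/- Let p ∈ [1,∞) and f ∈ L_p(0,1). If 1 + e_n(f) ≠ 0 for every n ∈ ℤ, then there exists g ∈ L_p(0,1) such that (1 + e_n(f))^{−1} = 1 + e_n(g) for every n ∈ ℤ. -/

import Mathlib

open MeasureTheory Complex Filter Set
open scoped Matrix.Norms.L2Operator ENNReal

noncomputable section

abbrev M2 := Matrix (Fin 2) (Fin 2) ℂ

def Bmat : M2 := !![0, 1; -1, 0]

def Jmat : M2 := !![1, 0; 0, -1]

/-- `expB τ = e^{-τ B} = [[cos τ, -sin τ],[sin τ, cos τ]]`. -/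
def expB (τ : ℂ) : M2 := !![Complex.cos τ, -Complex.sin τ; Complex.sin τ, Complex.cos τ]

/-- Lebesgue measure restricted to `(0,1)`. -/
def μ01 : Measure ℝ := volume.restrict (Set.Ioo 0 1)

/-- Lebesgue measure restricted to `(-1,1)`. -/
def μ11 : Measure ℝ := volume.restrict (Set.Ioo (-1) 1)

/-- A Dirac-form potential `Q = [[q₁,q₂],[q₂,-q₁]]`. -/
def IsDiracForm (Q : ℝ → M2) : Prop :=
  ∃ q1 q2 : ℝ → ℂ, ∀ x, Q x = !![q1 x, q2 x; q2 x, -q1 x]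

/-- A Dirac-form potential with real-valued entries. -/
def IsRealDiracForm (Q : ℝ → M2) : Prop :=
  ∃ q1 q2 : ℝ → ℝ, ∀ x, Q x = !![(q1 x : ℂ), (q2 x : ℂ); (q2 x : ℂ), -(q1 x : ℂ)]

/-- `U` is an absolutely continuous matrix solution of `B U' + Q U = λ U` a.e. on `(0,1)`. -/
def IsMatSolution (Q : ℝ → M2) (l : ℂ) (U : ℝ → M2) : Prop :=
  ∃ U' : ℝ → M2, IntegrableOn U' (Set.Ioo 0 1) ∧
    (∀ x ∈ Set.Icc (0:ℝ) 1, U x = U 0 + ∫ t in (0:ℝ)..x, U' t) ∧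
    (∀ᵐ x ∂μ01, Bmat * U' x + Q x * U x = l • U x)

/-- `u` is an absolutely continuous `ℂ²`-valued solution of `B u' + Q u = λ u` a.e. on `(0,1)`. -/
def IsVecSolution (Q : ℝ → M2) (l : ℂ) (u : ℝ → Fin 2 → ℂ) : Prop :=
  ∃ u' : ℝ → Fin 2 → ℂ, IntegrableOn u' (Set.Ioo 0 1) ∧
    (∀ x ∈ Set.Icc (0:ℝ) 1, u x = u 0 + ∫ t in (0:ℝ)..x, u' t) ∧
    (∀ᵐ x ∂μ01, Bmat.mulVec (u' x) + (Q x).mulVec (u x) = l • u x)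

/-- `λ` is an eigenvalue of the Dirac operator `A_j` (`j = 0` for `A₁`, `j = 1` for `A₂`):
there is a nonzero AC solution with `u₂(0) = 0` and `u_j(1) = 0`. -/
def IsEigenvalue (Q : ℝ → M2) (j : Fin 2) (l : ℝ) : Prop :=
  ∃ u : ℝ → Fin 2 → ℂ, IsVecSolution Q (l : ℂ) u ∧
    (∃ x ∈ Set.Icc (0:ℝ) 1, u x ≠ 0) ∧ u 0 1 = 0 ∧ u 1 j = 0

/-- `c₀(·,λ) = (cos λx, sin λx)ᵗ`. -/
def c0 (l : ℂ) (x : ℝ) : Fin 2 → ℂ := ![Complex.cos (l * x), Complex.sin (l * x)]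

/-- n-th Fourier coefficient `e_n(g) = ∫₀¹ e^{-2πinx} g(x) dx`. -/
def fc (g : ℝ → ℂ) (n : ℤ) : ℂ :=
  ∫ x in (0:ℝ)..1, Complex.exp (-2 * Real.pi * Complex.I * n * x) * g x

/-- The square of the `ℍ = L₂((0,1),ℂ²)` norm of `u`. -/
def hnormSq (u : ℝ → Fin 2 → ℂ) : ℝ :=
  ∫ x in Set.Ioo (0:ℝ) 1, (‖u x 0‖ ^ 2 + ‖u x 1‖ ^ 2)

/-- The `ℂ²` inner product `⟨v,w⟩ = v₁ w̄₁ + v₂ w̄₂`. -/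
def ip2 (v w : Fin 2 → ℂ) : ℂ := v 0 * star (w 0) + v 1 * star (w 1)

/-- The eigenvalue asymptotics `λ_n = π(n+1/2) + e_n(g)` for some `g ∈ L_p(0,1)`. -/
def LamAsymp (p : ℝ≥0∞) (lam : ℤ → ℝ) : Prop :=
  ∃ g : ℝ → ℂ, MemLp g p μ01 ∧
    ∀ n : ℤ, (lam n : ℂ) = Real.pi * (n + 1/2) + fc g n

/-- The eigenvalue asymptotics `μ_n = πn + e_n(g)` for some `g ∈ L_p(0,1)`. -/
def MuAsymp (p : ℝ≥0∞) (mu : ℤ → ℝ) : Prop :=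
  ∃ g : ℝ → ℂ, MemLp g p μ01 ∧
    ∀ n : ℤ, (mu n : ℂ) = Real.pi * n + fc g n

/-- The norming-constant asymptotics `α_n = 1 + e_n(g)` for some `g ∈ L_p(0,1)`. -/
def AlAsymp (p : ℝ≥0∞) (al : ℤ → ℝ) : Prop :=
  ∃ g : ℝ → ℂ, MemLp g p μ01 ∧ ∀ n : ℤ, (al n : ℂ) = 1 + fc g n

/-- Membership in the class `SD_p` of spectral data. -/
def MemSD (p : ℝ≥0∞) (lam mu : ℤ → ℝ) : Prop :=
  (∀ n : ℤ, lam (n - 1) < mu n ∧ mu n < lam n) ∧ LamAsymp p lam ∧ MuAsymp p mu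

/-- Membership in the kernel space `G_p(M₂)`: all slices lie in `L_p` and the slice maps are
continuous from `[0,1]` to `L_p((0,1),M₂)`. -/
def MemGp (p : ℝ≥0∞) (K : ℝ → ℝ → M2) : Prop :=
  (∀ x ∈ Set.Icc (0:ℝ) 1, MemLp (K x) p μ01) ∧
  (∀ t ∈ Set.Icc (0:ℝ) 1, MemLp (fun x => K x t) p μ01) ∧
  (∀ x₀ ∈ Set.Icc (0:ℝ) 1, ∀ ε > (0:ℝ), ∃ δ > (0:ℝ), ∀ x ∈ Set.Icc (0:ℝ) 1,
    |x - x₀| < δ → eLpNorm (fun t => K x t - K x₀ t) p μ01 < ENNReal.ofReal ε) ∧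
  (∀ t₀ ∈ Set.Icc (0:ℝ) 1, ∀ ε > (0:ℝ), ∃ δ > (0:ℝ), ∀ t ∈ Set.Icc (0:ℝ) 1,
    |t - t₀| < δ → eLpNorm (fun x => K x t - K x t₀) p μ01 < ENNReal.ofReal ε)

/-- The norm of the space `G_p(M₂)` (as an extended real number). -/
def gpNorm (p : ℝ≥0∞) (K : ℝ → ℝ → M2) : ℝ≥0∞ :=
  max (⨆ x ∈ Set.Icc (0:ℝ) 1, eLpNorm (K x) p μ01)
      (⨆ t ∈ Set.Icc (0:ℝ) 1, eLpNorm (fun x => K x t) p μ01)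


abbrev Circ := AddCircle (1 : ℝ)
abbrev hC : Measure Circ := AddCircle.haarAddCircle

lemma circ_integrable {p : ℝ≥0∞} [hp : Fact (1 ≤ p)] (u : Lp ℂ p hC) : Integrable u hC :=
  (Lp.memLp u).integrable hp.out

lemma circ_int_norm_le {p : ℝ≥0∞} [hp : Fact (1 ≤ p)] (u : Lp ℂ p hC) :
    ∫ x, ‖u x‖ ∂hC ≤ ‖u‖ := by
  rw [integral_norm_eq_lintegral_enorm (Lp.aestronglyMeasurable u), Lp.norm_def]
  refine ENNReal.toReal_mono (Lp.eLpNorm_ne_top u) ?_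
  rw [← eLpNorm_one_eq_lintegral_enorm]
  exact eLpNorm_le_eLpNorm_of_exponent_le hp.out (Lp.aestronglyMeasurable u)

/-- Fourier coefficient as a continuous functional. -/
def fcL (p : ℝ≥0∞) [hp : Fact (1 ≤ p)] (n : ℤ) : Lp ℂ p hC →L[ℂ] ℂ :=
  LinearMap.mkContinuous
    { toFun := fun u => fourierCoeff (T := 1) (u : Circ → ℂ) n
      map_add' := fun u v => by
        rw [fourierCoeff_congr_ae (Lp.coeFn_add u v),
          fourierCoeff.add (circ_integrable u) (circ_integrable v)]
        rfl
      map_smul' := fun c u => by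
        rw [fourierCoeff_congr_ae (Lp.coeFn_smul c u), fourierCoeff.const_smul]
        rfl } 1 (fun u => by
      rw [one_mul]
      refine le_trans ?_ (circ_int_norm_le u)
      refine (norm_integral_le_integral_norm _).trans (le_of_eq ?_)
      refine integral_congr_ae (ae_of_all _ fun x => ?_)
      simp only [norm_smul, fourier_apply, Circle.norm_coe, one_mul])

lemma fcL_apply {p : ℝ≥0∞} [hp : Fact (1 ≤ p)] (n : ℤ) (u : Lp ℂ p hC) :
    fcL p n u = fourierCoeff (T := 1) (u : Circ → ℂ) n := rfl

/-- translation -/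
def tr {p : ℝ≥0∞} (y : Circ) (u : Lp ℂ p hC) : Lp ℂ p hC := DomAddAct.mk (-y) +ᵥ u

lemma tr_cont {p : ℝ≥0∞} [Fact (1 ≤ p)] [Fact (p ≠ ∞)] (u : Lp ℂ p hC) :
    Continuous (fun y => tr y u) := by
  unfold tr
  have : Continuous (fun y : Circ => DomAddAct.mk (-y)) :=
    DomAddAct.continuous_mk.comp continuous_neg
  exact this.vadd continuous_const

lemma fcL_tr {p : ℝ≥0∞} [hp : Fact (1 ≤ p)] (n : ℤ) (y : Circ) (u : Lp ℂ p hC) :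
    fcL p n (tr y u) = fourier (-n) y * fcL p n u := by
  rw [fcL_apply, fcL_apply]
  have h : (tr y u : Circ → ℂ) =ᵐ[hC] fun x => u (-y + x) := by
    exact DomAddAct.vadd_Lp_ae_eq _ _
  rw [fourierCoeff_congr_ae h]
  unfold fourierCoeff
  rw [← integral_add_left_eq_self _ y, ← integral_const_mul]
  congr 1
  ext x
  simp only [neg_add_cancel_left, smul_eq_mul, ← mul_assoc]
  congr 1
  simp only [fourier_apply, smul_add, AddCircle.toCircle_add, Circle.coe_mul]

lemma conv_integrable {p : ℝ≥0∞} [Fact (1 ≤ p)] [Fact (p ≠ ∞)] (r u : Lp ℂ p hC) :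
    Integrable (fun y => r y • tr y u) hC := by
  refine (circ_integrable r).smul_bdd ‖u‖ (tr_cont u).aestronglyMeasurable_of_compactSpace ?_
  exact ae_of_all _ fun y => by simp [tr]

/-- convolution -/
def cv {p : ℝ≥0∞} [Fact (1 ≤ p)] (r u : Lp ℂ p hC) : Lp ℂ p hC := ∫ y, r y • tr y u ∂hC

lemma fcL_cv {p : ℝ≥0∞} [Fact (1 ≤ p)] [Fact (p ≠ ∞)] (n : ℤ) (r u : Lp ℂ p hC) :
    fcL p n (cv r u) = fcL p n r * fcL p n u := by
  unfold cv
  rw [← ContinuousLinearMap.integral_comp_comm _ (conv_integrable r u)]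
  simp only [map_smul, fcL_tr, smul_eq_mul]
  rw [fcL_apply n r, fourierCoeff, ← integral_mul_const]
  congr 1
  ext y
  simp only [smul_eq_mul]
  ring

lemma cv_dist {p : ℝ≥0∞} [Fact (1 ≤ p)] [Fact (p ≠ ∞)] (r u v : Lp ℂ p hC) :
    ‖cv r u - cv r v‖ ≤ ‖r‖ * ‖u - v‖ := by
  unfold cv
  rw [← integral_sub (conv_integrable r u) (conv_integrable r v)]
  refine (norm_integral_le_integral_norm _).trans ?_
  refine le_trans (le_of_eq ?_) (mul_le_mul_of_nonneg_right (circ_int_norm_le r) (norm_nonneg _))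
  rw [← integral_mul_const]
  congr 1
  ext y
  rw [← smul_sub, norm_smul]
  congr 1
  unfold tr
  rw [← DomAddAct.vadd_Lp_sub, DomAddAct.norm_vadd_Lp]

lemma exists_small {p : ℝ≥0∞} [Fact (1 ≤ p)] [Fact (p ≠ ∞)] (r : Lp ℂ p hC) (hr : ‖r‖ < 1) :
    ∃ h : Lp ℂ p hC, ∀ n, fcL p n h = - fcL p n r - fcL p n r * fcL p n h := by
  have hc : ContractingWith ‖r‖₊ (fun u => - r - cv r u) := by
    refine ⟨by exact_mod_cast hr, LipschitzWith.of_dist_le_mul fun u v => ?_⟩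
    rw [dist_eq_norm, dist_eq_norm]
    have : (- r - cv r u) - (- r - cv r v) = -(cv r u - cv r v) := by abel
    rw [this, norm_neg]
    exact cv_dist r u v
  refine ⟨ContractingWith.fixedPoint _ hc, fun n => ?_⟩
  have h := hc.fixedPoint_isFixedPt
  set w := ContractingWith.fixedPoint _ hc
  have h2 : - r - cv r w = w := h
  conv_lhs => rw [← h2]
  rw [map_sub, map_neg, fcL_cv]

lemma fcL_fourier {p : ℝ≥0∞} [Fact (1 ≤ p)] (n m : ℤ) :
    fcL p n (fourierLp (T := 1) p m) = if n = m then 1 else 0 := by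
  rw [fcL_apply, fourierCoeff_congr_ae (coeFn_fourierLp p m),
    ← fourierCoeff_congr_ae (coeFn_fourierLp 2 m), ← fourierBasis_repr]
  rw [← coe_fourierBasis, HilbertBasis.repr_self]
  by_cases h : n = m
  · simp [h, lp.single_apply]
  · simp [h, lp.single_apply]

lemma circ_main {p : ℝ≥0∞} [Fact (1 ≤ p)] [hp : Fact (p ≠ ∞)] (F : Lp ℂ p hC)
    (hF : ∀ n, 1 + fcL p n F ≠ 0) :
    ∃ G : Lp ℂ p hC, ∀ n, (1 + fcL p n F)⁻¹ = 1 + fcL p n G := by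
  have hd : F ∈ (Submodule.span ℂ (range (@fourierLp 1 _ p _))).topologicalClosure := by
    rw [span_fourierLp_closure_eq_top hp.out]; trivial
  obtain ⟨P, hP, hPF⟩ := Metric.mem_closure_iff.1 hd 1 one_pos
  obtain ⟨c, rfl⟩ := Finsupp.mem_span_range_iff_exists_finsupp.1 hP
  set P := c.sum fun i a => a • fourierLp (T := 1) p i with hPdef
  have hfP : ∀ n, n ∉ c.support → fcL p n P = 0 := by
    intro n hn
    rw [hPdef, Finsupp.sum, map_sum]
    refine Finset.sum_eq_zero fun i hi => ?_
    rw [map_smul, fcL_fourier, if_neg (fun h : n = i => hn (h ▸ hi)), smul_zero]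
  obtain ⟨h, hh⟩ := exists_small (F - P) (by rwa [← dist_eq_norm])
  refine ⟨h + ∑ m ∈ c.support, ((1 + fcL p m F)⁻¹ - 1 - fcL p m h) • fourierLp (T := 1) p m, 
    fun n => ?_⟩
  rw [map_add, map_sum]
  simp only [map_smul, fcL_fourier, smul_eq_mul, mul_ite, mul_one, mul_zero, Finset.sum_ite_eq]
  split_ifs with hn
  · ring
  · have h1 := hh n
    rw [map_sub, hfP n hn, sub_zero] at h1
    rw [add_zero]
    refine inv_eq_of_mul_eq_one_right ?_
    linear_combination h1

lemma fc_coe (G : Circ → ℂ) (n : ℤ) : fc (fun x => G x) n = fourierCoeff G n := by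
  rw [fourierCoeff_eq_intervalIntegral G n 0]
  simp only [fc, zero_add, div_one, one_smul, smul_eq_mul]
  congr 1
  ext x
  rw [fourier_coe_apply]
  congr 2
  push_cast
  ring

lemma mu01_eq : μ01 = volume.restrict (Ioc (0:ℝ) (0 + 1)) := by
  rw [μ01, zero_add]; exact Measure.restrict_congr_set Ioo_ae_eq_Ioc

/-- Wiener-type lemma for `X_p`: if `1 + e_n(f) ≠ 0` for all `n`, then
`(1 + e_n(f))⁻¹ = 1 + e_n(g)` for some `g ∈ L_p(0,1)`. -/
theorem statement18 (p : ℝ≥0∞) (hp : 1 ≤ p) (hp' : p ≠ ∞)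
    (f : ℝ → ℂ) (hf : MemLp f p μ01)
    (hne : ∀ n : ℤ, 1 + fc f n ≠ 0) :
    ∃ g : ℝ → ℂ, MemLp g p μ01 ∧ ∀ n : ℤ, (1 + fc f n)⁻¹ = 1 + fc g n := by
  have : Fact (1 ≤ p) := ⟨hp⟩
  have : Fact (p ≠ ∞) := ⟨hp'⟩
  rw [mu01_eq] at hf ⊢
  have hL : MemLp (AddCircle.liftIoc 1 0 f) p hC := memLp_haarAddCircle_iff.2 hf.memLp_liftIoc
  have hfc : ∀ n, fcL p n (hL.toLp _) = fc f n := by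
    intro n
    rw [fcL_apply, fourierCoeff_congr_ae hL.coeFn_toLp, ← fc_coe]
    unfold fc
    refine intervalIntegral.integral_congr_ae (ae_of_all _ fun x hx => ?_)
    rw [uIoc_of_le zero_le_one] at hx
    have hx' : x ∈ Ioc (0:ℝ) (0 + 1) := by rwa [zero_add]
    simp only [AddCircle.liftIoc_coe_apply hx']
  obtain ⟨G, hG⟩ := circ_main (hL.toLp _) (fun n => by rw [hfc]; exact hne n)
  refine ⟨fun x => G x, ?_, fun n => ?_⟩
  · exact (memLp_haarAddCircle_iff.1 (Lp.memLp G)).comp_measurePreserving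
      (AddCircle.measurePreserving_mk 1 0)
  · rw [fc_coe, ← hfc, hG, fcL_apply]
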